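/- Let Λ be a finitely aligned k-graph, let E ⊆ Λ be finite, and let {t_λ : λ ∈ Λ} be a collection of elements of a C*-algebra satisfying (TCK1), (TCK2) and (TCK3). Then for all (λ,μ),(σ,τ) ∈ ΠE ×_{d,s} ΠE we have (Θ(t)^{ΠE}_{λ,μ})* = Θ(t)^{ΠE}_{μ,λ} and Θ(t)^{ΠE}_{λ,μ} Θ(t)^{ΠE}_{σ,τ} = δ_{μ,σ} Θ(t)^{ΠE}_{λ,τ}. -/

import Mathlib

open scoped ENNReal

attribute [local instance] Classical.propDecidable

/-- Product of `f` over a set `S`, in some arbitrary order (junk value `1` if `S` is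
infinite).  Used for products of commuting projections. -/
noncomputable def listProd {ι A : Type*} [Monoid A] (S : Set ι) (f : ι → A) : A :=
  if h : S.Finite then (h.toFinset.toList.map f).prod else 1

/-- A `k`-graph: a countable category `Λ` (whose morphisms are the terms of `Path`, with
vertices identified with the morphisms of degree `0`) together with a degree functor
`d : Λ → ℕ^k` satisfying the factorisation property. -/
structure KGraph (k : ℕ) where
  Path : Type
  countable : Countable Path
  d : Path → Fin k → ℕ
  r : Path → Path
  s : Path → Path
  comp : Path → Path → Path
  d_r : ∀ lam, d (r lam) = 0
  d_s : ∀ lam, d (s lam) = 0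
  r_r : ∀ lam, r (r lam) = r lam
  s_r : ∀ lam, s (r lam) = r lam
  r_s : ∀ lam, r (s lam) = s lam
  s_s : ∀ lam, s (s lam) = s lam
  comp_source : ∀ lam, comp lam (s lam) = lam
  range_comp : ∀ lam, comp (r lam) lam = lam
  r_comp : ∀ lam mu, s lam = r mu → r (comp lam mu) = r lam
  s_comp : ∀ lam mu, s lam = r mu → s (comp lam mu) = s mu
  d_comp : ∀ lam mu, s lam = r mu → d (comp lam mu) = d lam + d mu
  comp_assoc : ∀ lam mu nu, s lam = r mu → s mu = r nu →
    comp (comp lam mu) nu = comp lam (comp mu nu)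
  factor : ∀ lam m n, d lam = m + n →
    ∃! p : Path × Path, s p.1 = r p.2 ∧ d p.1 = m ∧ d p.2 = n ∧ comp p.1 p.2 = lam

namespace KGraph

variable {k : ℕ} (Λ : KGraph k)

/-- Vertices are identified with the paths of degree `0`. -/
def IsVertex (v : Λ.Path) : Prop := Λ.d v = 0

/-- The unique factorisation of `lam` as a product of a path of degree `m` and the
remaining tail (junk value if `¬ m ≤ d lam`). -/
noncomputable def split (lam : Λ.Path) (m : Fin k → ℕ) : Λ.Path × Λ.Path :=
  if h : m ≤ Λ.d lam then
    (Λ.factor lam m (Λ.d lam - m) (by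
      funext i
      exact (Nat.add_sub_cancel' (h i)).symm)).choose
  else (lam, lam)

/-- The segment `λ(m,n)` of the path `λ`: the unique path of degree `n - m` such that
`λ = λ(0,m) λ(m,n) λ(n, d λ)` (meaningful for `m ≤ n ≤ d λ`). -/
noncomputable def seg (lam : Λ.Path) (m n : Fin k → ℕ) : Λ.Path :=
  (Λ.split (Λ.split lam n).1 m).2

/-- `MCE(μ,ν)`: minimal common extensions of `μ` and `ν`. -/
def MCE (mu nu : Λ.Path) : Set Λ.Path :=
  {lam | Λ.d lam = Λ.d mu ⊔ Λ.d nu ∧ Λ.seg lam 0 (Λ.d mu) = mu ∧ Λ.seg lam 0 (Λ.d nu) = nu}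

/-- `Λ^min(μ,ν) = {(α,β) : μα = νβ ∈ MCE(μ,ν)}`. -/
def Lmin (mu nu : Λ.Path) : Set (Λ.Path × Λ.Path) :=
  {p | Λ.s mu = Λ.r p.1 ∧ Λ.s nu = Λ.r p.2 ∧ Λ.comp mu p.1 = Λ.comp nu p.2 ∧
    Λ.comp mu p.1 ∈ Λ.MCE mu nu}

/-- `Ext(μ;E)`: extensions of `μ` with respect to `E`. -/
def Ext (mu : Λ.Path) (E : Set Λ.Path) : Set Λ.Path :=
  {a | Λ.r a = Λ.s mu ∧ ∃ nu ∈ E, ∃ b, (a, b) ∈ Λ.Lmin mu nu}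

/-- `Λ` is finitely aligned if all the sets `MCE(μ,ν)` are finite. -/
def FinitelyAligned : Prop := ∀ mu nu, (Λ.MCE mu nu).Finite

/-- `E ⊆ vΛ` is exhaustive if `Ext(λ;E) ≠ ∅` for all `λ ∈ vΛ`. -/
def Exhaustive (v : Λ.Path) (E : Set Λ.Path) : Prop :=
  ∀ lam, Λ.r lam = v → (Λ.Ext lam E).Nonempty

/-- `E ∈ vFE(Λ)`: `E ⊆ vΛ \ {v}` is finite and exhaustive (so `r(E) = v`). -/
def FEat (v : Λ.Path) (E : Set Λ.Path) : Prop :=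
  Λ.IsVertex v ∧ (∀ lam ∈ E, Λ.r lam = v ∧ lam ≠ v) ∧ E.Finite ∧ Λ.Exhaustive v E

/-- `FE(Λ)`: the finite exhaustive sets. -/
def FE : Set (Set Λ.Path) := {E | ∃ v, Λ.FEat v E}

/-- `λE = {λμ : μ ∈ E, r(μ) = s(λ)}`. -/
def lamSet (lam : Λ.Path) (E : Set Λ.Path) : Set Λ.Path :=
  {x | ∃ mu ∈ E, Λ.s lam = Λ.r mu ∧ Λ.comp lam mu = x}

/-- `EΛ = {λμ : λ ∈ E, r(μ) = s(λ)}`. -/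
def setLam (E : Set Λ.Path) : Set Λ.Path :=
  {x | ∃ lam ∈ E, ∃ mu, Λ.s lam = Λ.r mu ∧ Λ.comp lam mu = x}

/-- `𝓔 ⊆ FE(Λ)` is satiated if it satisfies (S1)--(S4). -/
def Satiated (𝓔 : Set (Set Λ.Path)) : Prop :=
  𝓔 ⊆ Λ.FE ∧
  (∀ G ∈ 𝓔, ∀ E ∈ Λ.FE, G ⊆ E → E ∈ 𝓔) ∧
  (∀ G ∈ 𝓔, ∀ v, Λ.FEat v G → ∀ mu, Λ.r mu = v → mu ∉ Λ.setLam G → Λ.Ext mu G ∈ 𝓔) ∧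
  (∀ G ∈ 𝓔, ∀ n : Λ.Path → Fin k → ℕ, (∀ lam ∈ G, 0 < n lam ∧ n lam ≤ Λ.d lam) →
    ((fun lam => Λ.seg lam 0 (n lam)) '' G) ∈ 𝓔) ∧
  (∀ G ∈ 𝓔, ∀ G' ⊆ G, ∀ Gl : Λ.Path → Set Λ.Path,
    (∀ lam ∈ G', Gl lam ∈ 𝓔 ∧ Λ.FEat (Λ.s lam) (Gl lam)) →
    ((G \ G') ∪ ⋃ lam ∈ G', Λ.lamSet lam (Gl lam)) ∈ 𝓔)

/-- The satiation `𝓔̄` of `𝓔`: the smallest satiated subset of `FE(Λ)` containing `𝓔`. -/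
def satiation (𝓔 : Set (Set Λ.Path)) : Set (Set Λ.Path) :=
  ⋂₀ {F | 𝓔 ⊆ F ∧ Λ.Satiated F}

/-- `ΠE`: the smallest subset of `Λ` containing `E` which is closed under the operation
`(λ,μ,σ) ↦ λ Ext(μ;{σ})` for `λ,μ,σ ∈ ΠE` with `d(λ) = d(μ)`, `s(λ) = s(μ)`. -/
def PiSet (E : Set Λ.Path) : Set Λ.Path :=
  ⋂₀ {G | E ⊆ G ∧ ∀ lam mu sig, lam ∈ G → mu ∈ G → sig ∈ G →
    Λ.d lam = Λ.d mu → Λ.s lam = Λ.s mu → Λ.lamSet lam (Λ.Ext mu {sig}) ⊆ G}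

/-- `Σ₁(𝓔)`: finite sets `F ⊆ r(E)Λ \ Λ⁰` containing some `E ∈ 𝓔`. -/
def Sig1 (𝓔 : Set (Set Λ.Path)) : Set (Set Λ.Path) :=
  {F | ∃ E ∈ 𝓔, ∃ v, Λ.FEat v E ∧ E ⊆ F ∧ F.Finite ∧
    ∀ lam ∈ F, Λ.r lam = v ∧ ¬ Λ.IsVertex lam}

/-- `Σ₂(𝓔) = {Ext(μ;E) : E ∈ 𝓔, μ ∈ r(E)Λ \ EΛ}`. -/
def Sig2 (𝓔 : Set (Set Λ.Path)) : Set (Set Λ.Path) :=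
  {F | ∃ E ∈ 𝓔, ∃ v, Λ.FEat v E ∧ ∃ mu, Λ.r mu = v ∧ mu ∉ Λ.setLam E ∧ F = Λ.Ext mu E}

/-- `Σ₃(𝓔) = {{λ(0,n_λ) : λ ∈ E} : E ∈ 𝓔, 0 < n_λ ≤ d(λ)}`. -/
def Sig3 (𝓔 : Set (Set Λ.Path)) : Set (Set Λ.Path) :=
  {F | ∃ E ∈ 𝓔, ∃ n : Λ.Path → Fin k → ℕ, (∀ lam ∈ E, 0 < n lam ∧ n lam ≤ Λ.d lam) ∧
    F = (fun lam => Λ.seg lam 0 (n lam)) '' E}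

/-- `Σ₄(𝓔) = {(E \ F) ∪ ⋃_{λ ∈ F} λ F_λ : E ∈ 𝓔, F ⊆ E, F_λ ∈ s(λ)𝓔}`. -/
def Sig4 (𝓔 : Set (Set Λ.Path)) : Set (Set Λ.Path) :=
  {G | ∃ E ∈ 𝓔, ∃ F ⊆ E, ∃ Fl : Λ.Path → Set Λ.Path,
    (∀ lam ∈ F, Fl lam ∈ 𝓔 ∧ Λ.FEat (Λ.s lam) (Fl lam)) ∧
    G = (E \ F) ∪ ⋃ lam ∈ F, Λ.lamSet lam (Fl lam)}

/-- `Σ = Σ₄ ∘ Σ₃ ∘ Σ₂ ∘ Σ₁`. -/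
def SigmaStep (𝓔 : Set (Set Λ.Path)) : Set (Set Λ.Path) :=
  Λ.Sig4 (Λ.Sig3 (Λ.Sig2 (Λ.Sig1 𝓔)))

/-- `Σ^∞(𝓔) = ⋃_{n ≥ 1} Σ^n(𝓔)`. -/
def SigmaInf (𝓔 : Set (Set Λ.Path)) : Set (Set Λ.Path) :=
  ⋃ n : ℕ, (Λ.SigmaStep)^[n + 1] 𝓔

section StarAlgebra

variable {A : Type*} [Ring A] [StarRing A]

/-- The product `∏_{λ ∈ E} (t_v - t_λ t_λ*)` (the factors pairwise commute for any
family satisfying (TCK1)--(TCK3), so the implicit choice of ordering is immaterial). -/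
noncomputable def gapProd (t : Λ.Path → A) (v : Λ.Path) (E : Set Λ.Path) : A :=
  listProd E fun lam => t v - t lam * star (t lam)

/-- Conditions (TCK1)--(TCK3) on a family `{t_λ}`. -/
def TCKFamily (t : Λ.Path → A) : Prop :=
  (∀ v, Λ.IsVertex v → star (t v) = t v ∧ t v * t v = t v) ∧
  (∀ v w, Λ.IsVertex v → Λ.IsVertex w → v ≠ w → t v * t w = 0) ∧
  (∀ lam mu, Λ.s lam = Λ.r mu → t lam * t mu = t (Λ.comp lam mu)) ∧
  (∀ lam mu, star (t lam) * t mu = ∑ᶠ p ∈ Λ.Lmin lam mu, t p.1 * star (t p.2))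

/-- A relative Cuntz-Krieger `(Λ;𝓔)`-family: (TCK1)--(TCK3) together with (CK). -/
def RCKFamily (𝓔 : Set (Set Λ.Path)) (t : Λ.Path → A) : Prop :=
  Λ.TCKFamily t ∧ ∀ E ∈ 𝓔, ∀ v, Λ.FEat v E → Λ.gapProd t v E = 0

/-- `Θ(t)^{ΠE}_{λ,μ} = t_λ (∏_{λν ∈ ΠE, d(ν) > 0} (t_{s(λ)} - t_ν t_ν*)) t_μ*`. -/
noncomputable def Theta (t : Λ.Path → A) (E : Set Λ.Path) (lam mu : Λ.Path) : A :=
  t lam *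
    listProd {nu | Λ.s lam = Λ.r nu ∧ ¬ Λ.IsVertex nu ∧ Λ.comp lam nu ∈ Λ.PiSet E}
      (fun nu => t (Λ.s lam) - t nu * star (t nu)) *
    star (t mu)

end StarAlgebra

end KGraph

/-- A graph morphism `x : Ω_{k,m} → Λ`, encoded by its length `m = d(x) ∈ (ℕ∪{∞})^k`
and its values `x(p,q)` on the morphisms `(p,q)` of `Ω_{k,m}` (with the junk value
`x(0,0)` outside the meaningful domain, so graph morphisms are extensional). -/
structure GMor {k : ℕ} (Λ : KGraph k) where
  len : Fin k → ℕ∞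
  seg : (Fin k → ℕ) → (Fin k → ℕ) → Λ.Path
  d_seg : ∀ p q, p ≤ q → (∀ i, (q i : ℕ∞) ≤ len i) → Λ.d (seg p q) = q - p
  r_seg : ∀ p q, p ≤ q → (∀ i, (q i : ℕ∞) ≤ len i) → Λ.r (seg p q) = seg p p
  s_seg : ∀ p q, p ≤ q → (∀ i, (q i : ℕ∞) ≤ len i) → Λ.s (seg p q) = seg q q
  comp_seg : ∀ p q u, p ≤ q → q ≤ u → (∀ i, (u i : ℕ∞) ≤ len i) →
    Λ.comp (seg p q) (seg q u) = seg p u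
  seg_junk : ∀ p q, ¬ (p ≤ q ∧ ∀ i, (q i : ℕ∞) ≤ len i) → seg p q = seg 0 0

namespace GMor

variable {k : ℕ} {Λ : KGraph k}

/-- The range `r(x) = x(0)` of a graph morphism. -/
def range (x : GMor Λ) : Λ.Path := x.seg 0 0

/-- `y = x|_n^{d(x)}`, the restriction of `x` (defined for `n ≤ d(x)`):
`d(y) = d(x) - n` and `y(p,q) = x(n+p, n+q)`. -/
def IsRestriction (y x : GMor Λ) (n : Fin k → ℕ) : Prop :=
  (∀ i, y.len i = x.len i - (n i : ℕ∞)) ∧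
  ∀ p q, p ≤ q → (∀ i, (q i : ℕ∞) ≤ y.len i) → y.seg p q = x.seg (n + p) (n + q)

/-- `y = λx`, the extension of `x` by `λ ∈ Λ r(x)`: `d(y) = d(λ) + d(x)`,
`y(0, d(λ)) = λ` and `y(d(λ), d(λ)+n) = x(0,n)` for `n ≤ d(x)`. -/
def IsExtension (y : GMor Λ) (lam : Λ.Path) (x : GMor Λ) : Prop :=
  (∀ i, y.len i = (Λ.d lam i : ℕ∞) + x.len i) ∧
  y.seg 0 (Λ.d lam) = lam ∧
  ∀ n : Fin k → ℕ, (∀ i, (n i : ℕ∞) ≤ x.len i) →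
    y.seg (Λ.d lam) (Λ.d lam + n) = x.seg 0 n

/-- `x ∈ FΛ^∞`: `x` has an initial segment belonging to `F`. -/
def HasInit (x : GMor Λ) (F : Set Λ.Path) : Prop :=
  ∃ lam ∈ F, (∀ i, (Λ.d lam i : ℕ∞) ≤ x.len i) ∧ x.seg 0 (Λ.d lam) = lam

/-- `z` restricts to `x` on `Ω_{k, d(x)}`. -/
def Agrees (z x : GMor Λ) : Prop :=
  ∀ p q, p ≤ q → (∀ i, (q i : ℕ∞) ≤ x.len i) → z.seg p q = x.seg p q

/-- `z ∈ MCE(x,y)` for graph morphisms `x, y`. -/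
def IsMCE (z x y : GMor Λ) : Prop :=
  (∀ i, z.len i = max (x.len i) (y.len i)) ∧ z.Agrees x ∧ z.Agrees y

/-- `x` is aperiodic: for distinct `λ, μ ∈ Λ r(x)`, `MCE(λx, μx) = ∅`. -/
def Aperiodic (x : GMor Λ) : Prop :=
  ∀ lam mu : Λ.Path, lam ≠ mu → Λ.s lam = x.range → Λ.s mu = x.range →
    ∀ lx mx : GMor Λ, lx.IsExtension lam x → mx.IsExtension mu x →
      ∀ z : GMor Λ, ¬ z.IsMCE lx mx

end GMor

namespace KGraph

variable {k : ℕ} (Λ : KGraph k)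

/-- `x ∈ ∂(Λ;𝓔)`: an `𝓔`-compatible boundary path. -/
def IsBdry (𝓔 : Set (Set Λ.Path)) (x : GMor Λ) : Prop :=
  ∀ n : Fin k → ℕ, (∀ i, (n i : ℕ∞) ≤ x.len i) →
    ∀ E ∈ 𝓔, Λ.FEat (x.seg n n) E →
      ∃ lam ∈ E, (∀ i, ((n + Λ.d lam) i : ℕ∞) ≤ x.len i) ∧ x.seg n (n + Λ.d lam) = lam

/-- Condition (C): aperiodic `𝓔`-compatible boundary paths out of every vertex, and
avoiding any given `F ∈ vFE(Λ) \ 𝓔`. -/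
def CondC (𝓔 : Set (Set Λ.Path)) : Prop :=
  (∀ v, Λ.IsVertex v → ∃ x : GMor Λ, Λ.IsBdry 𝓔 x ∧ x.range = v ∧ x.Aperiodic) ∧
  (∀ v F, Λ.FEat v F → F ∉ 𝓔 →
    ∃ x : GMor Λ, Λ.IsBdry 𝓔 x ∧ x.range = v ∧ ¬ x.HasInit F ∧ x.Aperiodic)

end KGraph

namespace KGraph

section Paths

variable {k : ℕ} {Λ : KGraph k}

theorem comp_inj {a b a' b' : Λ.Path} (h : Λ.s a = Λ.r b) (h' : Λ.s a' = Λ.r b')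
    (hd : Λ.d a = Λ.d a') (hc : Λ.comp a b = Λ.comp a' b') : a = a' ∧ b = b' := by
  have h1 := Λ.d_comp a b h
  have h2 := Λ.d_comp a' b' h'
  have hb : Λ.d b = Λ.d b' := by
    rw [hc, h2, hd] at h1
    exact (add_left_cancel h1).symm
  obtain ⟨p, -, hp⟩ := Λ.factor (Λ.comp a b) (Λ.d a) (Λ.d b) h1
  have e1 := hp (a, b) ⟨h, rfl, rfl, rfl⟩
  have e2 := hp (a', b') ⟨h', hd.symm, hb.symm, hc.symm⟩
  simpa using e1.trans e2.symm

theorem exists_factor (x : Λ.Path) {m : Fin k → ℕ} (hm : m ≤ Λ.d x) :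
    ∃ a b, Λ.s a = Λ.r b ∧ Λ.d a = m ∧ Λ.comp a b = x := by
  obtain ⟨p, ⟨h1, h2, -, h4⟩, -⟩ :=
    Λ.factor x m (Λ.d x - m) (add_tsub_cancel_of_le hm).symm
  exact ⟨p.1, p.2, h1, h2, h4⟩

/-- If an initial segment of `pa` is longer than `p`, then it extends `p`. -/
theorem exists_factor_of_comp_eq {p a x y : Λ.Path} (hpa : Λ.s p = Λ.r a)
    (hxy : Λ.s x = Λ.r y) (he : Λ.comp x y = Λ.comp p a) (hd : Λ.d p ≤ Λ.d x) :
    ∃ b, Λ.s p = Λ.r b ∧ Λ.comp p b = x ∧ Λ.s b = Λ.r y ∧ Λ.comp b y = a := by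
  obtain ⟨q, b, hqb, hq, rfl⟩ := exists_factor x hd
  have hby : Λ.s b = Λ.r y := by rw [← hxy, Λ.s_comp q b hqb]
  rw [Λ.comp_assoc q b y hqb hby] at he
  obtain ⟨rfl, rfl⟩ := comp_inj (by rw [Λ.r_comp b y hby, hqb]) hpa hq he
  exact ⟨b, hqb, rfl, hby, rfl⟩

theorem IsVertex.r_eq_s {v : Λ.Path} (hv : Λ.IsVertex v) : Λ.r v = v ∧ v = Λ.s v :=
  comp_inj (Λ.s_r v) (Λ.r_s v).symm ((Λ.d_r v).trans hv.symm)
    ((Λ.range_comp v).trans (Λ.comp_source v).symm)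

theorem IsVertex.comp_eq {a v : Λ.Path} (hv : Λ.IsVertex v) (h : Λ.s a = Λ.r v) :
    Λ.comp a v = a := by
  rw [hv.r_eq_s.1] at h
  rw [← h, Λ.comp_source]

theorem split_spec {x a b : Λ.Path} (h : Λ.s a = Λ.r b) (hx : Λ.comp a b = x) :
    Λ.split x (Λ.d a) = (a, b) := by
  have hd := Λ.d_comp a b h
  rw [hx] at hd
  have hm : Λ.d a ≤ Λ.d x := by rw [hd]; exact le_self_add
  unfold split
  rw [dif_pos hm]
  have hs := (Λ.factor x (Λ.d a) (Λ.d x - Λ.d a)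
    (add_tsub_cancel_of_le hm).symm).choose_spec.1
  have hi := comp_inj hs.1 h hs.2.1 (hs.2.2.2.trans hx.symm)
  exact Prod.ext hi.1 hi.2

theorem seg_zero_comp {a b : Λ.Path} (h : Λ.s a = Λ.r b) :
    Λ.seg (Λ.comp a b) 0 (Λ.d a) = a := by
  have h2 := split_spec (Λ.s_r a) (Λ.range_comp a)
  rw [Λ.d_r] at h2
  rw [seg, split_spec h rfl, h2]

theorem mem_Lmin_iff {mu nu : Λ.Path} {p : Λ.Path × Λ.Path} :
    p ∈ Λ.Lmin mu nu ↔ Λ.s mu = Λ.r p.1 ∧ Λ.s nu = Λ.r p.2 ∧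
      Λ.comp mu p.1 = Λ.comp nu p.2 ∧ Λ.d (Λ.comp mu p.1) = Λ.d mu ⊔ Λ.d nu := by
  refine ⟨fun h => ⟨h.1, h.2.1, h.2.2.1, h.2.2.2.1⟩,
    fun h => ⟨h.1, h.2.1, h.2.2.1, h.2.2.2, seg_zero_comp h.1, ?_⟩⟩
  rw [h.2.2.1]
  exact seg_zero_comp h.2.1

theorem swap_mem_Lmin {mu nu : Λ.Path} {p : Λ.Path × Λ.Path} (h : p ∈ Λ.Lmin mu nu) :
    p.swap ∈ Λ.Lmin nu mu := by
  rw [mem_Lmin_iff] at h ⊢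
  obtain ⟨h1, h2, h3, h4⟩ := h
  exact ⟨h2, h1, h3.symm, by rw [sup_comm, ← h4, h3]; rfl⟩

theorem Lmin_finite (hΛ : Λ.FinitelyAligned) (mu nu : Λ.Path) : (Λ.Lmin mu nu).Finite := by
  refine Set.Finite.of_finite_image (f := fun p => Λ.comp mu p.1)
    ((hΛ mu nu).subset ?_) ?_
  · rintro _ ⟨p, hp, rfl⟩
    exact hp.2.2.2
  · intro p hp q hq h
    have h1 := comp_inj hp.1 hq.1 rfl h
    have h2 := comp_inj hp.2.1 hq.2.1 rfl (hp.2.2.1.symm.trans (h.trans hq.2.2.1))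
    exact Prod.ext h1.2 h2.2

theorem Lmin_self (mu : Λ.Path) : Λ.Lmin mu mu = {(Λ.s mu, Λ.s mu)} := by
  ext ⟨a, b⟩
  simp only [mem_Lmin_iff, sup_idem, Set.mem_singleton_iff, Prod.mk.injEq]
  constructor
  · rintro ⟨h1, h2, h3, h4⟩
    have h5 := comp_inj h1 h2 rfl h3
    rw [Λ.d_comp mu a h1] at h4
    have ha : Λ.IsVertex a := left_eq_add.mp h4.symm
    rw [← h5.2, h1, ha.r_eq_s.1]
    exact ⟨rfl, rfl⟩
  · rintro ⟨rfl, rfl⟩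
    exact ⟨(Λ.r_s mu).symm, (Λ.r_s mu).symm, rfl, by rw [Λ.comp_source]⟩

theorem mem_Lmin_comp {mu a : Λ.Path} (h : Λ.s mu = Λ.r a) :
    (a, Λ.s a) ∈ Λ.Lmin mu (Λ.comp mu a) := by
  have hs := Λ.s_comp mu a h
  refine mem_Lmin_iff.2 ⟨h, by rw [hs, Λ.r_s], ?_, ?_⟩
  · rw [← hs, Λ.comp_source]
  · rw [Λ.d_comp mu a h]
    exact (sup_eq_right.2 le_self_add).symm

theorem lamSet_Ext_finite (hΛ : Λ.FinitelyAligned) (lam mu sig : Λ.Path) :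
    (Λ.lamSet lam (Λ.Ext mu {sig})).Finite := by
  refine ((Lmin_finite hΛ mu sig).image fun p => Λ.comp lam p.1).subset ?_
  rintro _ ⟨a, ⟨-, nu, rfl, b, hb⟩, -, rfl⟩
  exact ⟨(a, b), hb, rfl⟩

theorem comp_mem_lamSet_Ext {lam mu sig a b : Λ.Path} (hs : Λ.s lam = Λ.s mu)
    (h : (a, b) ∈ Λ.Lmin mu sig) : Λ.comp lam a ∈ Λ.lamSet lam (Λ.Ext mu {sig}) :=
  ⟨a, ⟨h.1.symm, sig, rfl, b, h⟩, hs.trans h.1, rfl⟩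

end Paths

section PiSet

variable {k : ℕ} {Λ : KGraph k} {E : Set Λ.Path}

theorem subset_PiSet : E ⊆ Λ.PiSet E := Set.subset_sInter fun _ hG => hG.1

theorem PiSet_induction {G : Set Λ.Path} (hE : E ⊆ G)
    (hG : ∀ lam mu sig a b, lam ∈ Λ.PiSet E → mu ∈ Λ.PiSet E → sig ∈ Λ.PiSet E →
      lam ∈ G → mu ∈ G → sig ∈ G → Λ.d lam = Λ.d mu → Λ.s lam = Λ.s mu →
      (a, b) ∈ Λ.Lmin mu sig → Λ.comp lam a ∈ G) :
    Λ.PiSet E ⊆ G := by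
  have hP : Λ.PiSet E ⊆ Λ.PiSet E ∩ G := by
    refine Set.sInter_subset_of_mem ⟨Set.subset_inter subset_PiSet hE, ?_⟩
    intro lam mu sig hl hm hs hd hss x hx
    refine ⟨Set.mem_sInter.2 fun G' hG' => ?_, ?_⟩
    · exact hG'.2 lam mu sig (Set.mem_sInter.1 hl.1 G' hG') (Set.mem_sInter.1 hm.1 G' hG')
        (Set.mem_sInter.1 hs.1 G' hG') hd hss hx
    · obtain ⟨a, ⟨-, nu, rfl, b, hb⟩, -, rfl⟩ := hx
      exact hG lam mu nu a b hl.1 hm.1 hs.1 hl.2 hm.2 hs.2 hd hss hb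
  exact hP.trans Set.inter_subset_right

theorem comp_mem_PiSet_of_mem_Lmin {lam mu sig a b : Λ.Path} (hl : lam ∈ Λ.PiSet E)
    (hm : mu ∈ Λ.PiSet E) (hsig : sig ∈ Λ.PiSet E) (hd : Λ.d lam = Λ.d mu)
    (hs : Λ.s lam = Λ.s mu) (h : (a, b) ∈ Λ.Lmin mu sig) : Λ.comp lam a ∈ Λ.PiSet E :=
  Set.mem_sInter.2 fun G hG =>
    hG.2 lam mu sig (Set.mem_sInter.1 hl G hG) (Set.mem_sInter.1 hm G hG)
      (Set.mem_sInter.1 hsig G hG) hd hs (comp_mem_lamSet_Ext hs h)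

theorem comp_mem_PiSet_of_comp_mem {lam mu a : Λ.Path} (hl : lam ∈ Λ.PiSet E)
    (hm : mu ∈ Λ.PiSet E) (hd : Λ.d lam = Λ.d mu) (hs : Λ.s lam = Λ.s mu)
    (ha : Λ.s mu = Λ.r a) (h : Λ.comp mu a ∈ Λ.PiSet E) : Λ.comp lam a ∈ Λ.PiSet E :=
  comp_mem_PiSet_of_mem_Lmin hl hm h hd hs (mem_Lmin_comp ha)

theorem exists_d_le_of_mem_PiSet (hE : E.Finite) : ∃ N, ∀ x ∈ Λ.PiSet E, Λ.d x ≤ N := by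
  obtain ⟨N, hN⟩ := (hE.image Λ.d).bddAbove
  refine ⟨N, PiSet_induction (G := {x | Λ.d x ≤ N})
    (fun x hx => hN (Set.mem_image_of_mem _ hx)) ?_⟩
  intro lam mu sig a b _ _ _ hl hm hsig hd hs h
  have h' := mem_Lmin_iff.1 h
  have e : Λ.d (Λ.comp lam a) = Λ.d mu ⊔ Λ.d sig := by
    rw [← h'.2.2.2, Λ.d_comp _ _ (hs.trans h.1), Λ.d_comp _ _ h.1, hd]
  change Λ.d (Λ.comp lam a) ≤ N
  rw [e]
  exact sup_le hm hsig

/-- Elements of `PiSet E` obtained directly from elements of degree less than `n`, together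
with `E`. -/
def directPart (Λ : KGraph k) (E : Set Λ.Path) (n : Fin k → ℕ) : Set Λ.Path :=
  E ∪ ⋃ lam ∈ {x ∈ Λ.PiSet E | Λ.d x < n}, ⋃ mu ∈ {x ∈ Λ.PiSet E | Λ.d x < n},
    ⋃ sig ∈ {x ∈ Λ.PiSet E | Λ.d x < n}, Λ.lamSet lam (Λ.Ext mu {sig})

/-- The paths `pa` with `p ∈ PiSet E` of degree less than `n` and `a` the tail of a member of
`directPart Λ E n`. -/
def graftPart (Λ : KGraph k) (E : Set Λ.Path) (n : Fin k → ℕ) : Set Λ.Path :=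
  {x | ∃ p ∈ Λ.PiSet E, Λ.d p < n ∧ ∃ q a, Λ.comp q a ∈ directPart Λ E n ∧
    Λ.d q = Λ.d p ∧ Λ.s q = Λ.r a ∧ Λ.s p = Λ.r a ∧ Λ.comp p a = x}

theorem mem_directPart {n : Fin k → ℕ} {lam mu sig a b : Λ.Path} (hl : lam ∈ Λ.PiSet E)
    (hm : mu ∈ Λ.PiSet E) (hsig : sig ∈ Λ.PiSet E) (hln : Λ.d lam < n) (hmn : Λ.d mu < n)
    (hsn : Λ.d sig < n) (hs : Λ.s lam = Λ.s mu) (h : (a, b) ∈ Λ.Lmin mu sig) :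
    Λ.comp lam a ∈ directPart Λ E n :=
  Or.inr <| Set.mem_biUnion (⟨hl, hln⟩ : lam ∈ {x ∈ Λ.PiSet E | Λ.d x < n}) <|
    Set.mem_biUnion (⟨hm, hmn⟩ : mu ∈ {x ∈ Λ.PiSet E | Λ.d x < n}) <|
    Set.mem_biUnion (⟨hsig, hsn⟩ : sig ∈ {x ∈ Λ.PiSet E | Λ.d x < n}) <|
    comp_mem_lamSet_Ext hs h

theorem directPart_finite (hΛ : Λ.FinitelyAligned) (hE : E.Finite) {n : Fin k → ℕ}
    (hn : {x ∈ Λ.PiSet E | Λ.d x < n}.Finite) : (directPart Λ E n).Finite :=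
  hE.union <| hn.biUnion fun _ _ => hn.biUnion fun _ _ => hn.biUnion fun _ _ =>
    lamSet_Ext_finite hΛ _ _ _

theorem graftPart_finite (hΛ : Λ.FinitelyAligned) (hE : E.Finite) {n : Fin k → ℕ}
    (hn : {x ∈ Λ.PiSet E | Λ.d x < n}.Finite) : (graftPart Λ E n).Finite := by
  refine (Set.Finite.image2 (fun p c => Λ.comp p (Λ.split c (Λ.d p)).2) hn
    (directPart_finite hΛ hE hn)).subset ?_
  rintro x ⟨p, hp, hpn, q, a, hc, hd, hq, -, rfl⟩
  refine ⟨p, ⟨hp, hpn⟩, _, hc, ?_⟩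
  simp only [← hd, split_spec hq rfl]

theorem comp_mem_graftPart {n : Fin k → ℕ} {lam mu a : Λ.Path} (hl : lam ∈ Λ.PiSet E)
    (hm : mu ∈ Λ.PiSet E) (hd : Λ.d lam = Λ.d mu) (hs : Λ.s lam = Λ.s mu)
    (ha : Λ.s mu = Λ.r a) (hmn : Λ.d mu < n) (hn : Λ.d (Λ.comp mu a) = n)
    (h : Λ.comp mu a ∈ directPart Λ E n ∪ graftPart Λ E n) :
    Λ.comp lam a ∈ graftPart Λ E n := by
  have direct (h : Λ.comp mu a ∈ directPart Λ E n) : Λ.comp lam a ∈ graftPart Λ E n :=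
    ⟨lam, hl, hd ▸ hmn, mu, a, h, hd.symm, ha, hs.trans ha, rfl⟩
  obtain h | ⟨p, hp, hpn, q, c, hqc, hdq, hq, hpc, he⟩ := h
  · exact direct h
  have hM : Λ.d p ⊔ Λ.d mu ≤ n := sup_le hpn.le hmn.le
  obtain ⟨x, y, hxy, hdx, hx⟩ := exists_factor (Λ.comp mu a) (hM.trans hn.ge)
  obtain ⟨c1, hpc1, rfl, hc1, rfl⟩ :=
    exists_factor_of_comp_eq hpc hxy (hx.trans he.symm) (hdx.symm ▸ le_sup_left)
  obtain ⟨a1, hma1, hx', ha1, rfl⟩ :=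
    exists_factor_of_comp_eq ha hxy hx (hdx.symm ▸ le_sup_right)
  have hmin : (c1, a1) ∈ Λ.Lmin p mu := mem_Lmin_iff.2 ⟨hpc1, hma1, hx'.symm, hdx⟩
  obtain hlt | heq := hM.lt_or_eq
  · have hla1 : Λ.s lam = Λ.r a1 := hs.trans hma1
    have hqc1 : Λ.s q = Λ.r c1 := by rw [hq, Λ.r_comp c1 y hc1]
    refine ⟨Λ.comp lam a1,
      comp_mem_PiSet_of_mem_Lmin hl hm hp hd hs (swap_mem_Lmin hmin), ?_,
      Λ.comp q c1, y, ?_, ?_, ?_, ?_, ?_⟩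
    · rw [Λ.d_comp _ _ hla1, hd, ← Λ.d_comp _ _ hma1, hx', hdx]
      exact hlt
    · rwa [Λ.comp_assoc _ _ _ hqc1 hc1]
    · rw [Λ.d_comp _ _ hla1, hd, ← Λ.d_comp _ _ hma1, hx', Λ.d_comp _ _ hpc1,
        Λ.d_comp _ _ hqc1, hdq]
    · rw [Λ.s_comp _ _ hqc1, hc1]
    · rw [Λ.s_comp _ _ hla1, ha1]
    · rw [Λ.comp_assoc _ _ _ hla1 ha1]
  · have hy : Λ.IsVertex y := by
      have hdy := Λ.d_comp _ _ hxy
      rw [hx, hn, hdx, heq] at hdy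
      exact left_eq_add.mp hdy
    rw [hy.comp_eq hxy] at hx
    apply direct
    rw [← hx]
    exact mem_directPart hp hp hm hpn hpn hmn rfl hmin

theorem PiSet_layer_subset (n : Fin k → ℕ) :
    {x ∈ Λ.PiSet E | Λ.d x = n} ⊆ directPart Λ E n ∪ graftPart Λ E n := by
  have key : Λ.PiSet E ⊆ {x | Λ.d x = n → x ∈ directPart Λ E n ∪ graftPart Λ E n} := by
    refine PiSet_induction (fun x hx _ => Or.inl (Or.inl hx)) ?_
    intro lam mu sig a b hl hm hsig hlG hmG hsG hd hs h hn
    obtain ⟨ha, hb, hab, hdab⟩ := mem_Lmin_iff.1 h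
    have hn' : Λ.d (Λ.comp mu a) = n := by
      rw [← hn, Λ.d_comp _ _ (hs.trans ha), Λ.d_comp _ _ ha, hd]
    have hM : Λ.d mu ⊔ Λ.d sig = n := hdab.symm.trans hn'
    obtain hmn | hmn := (le_sup_left.trans_eq hM).lt_or_eq
    · obtain hsn | hsn := (le_sup_right.trans_eq hM).lt_or_eq
      · exact Or.inl (mem_directPart hl hm hsig (hd ▸ hmn) hmn hsn hs h)
      · have hbv : Λ.IsVertex b := by
          have hdb := Λ.d_comp _ _ hb
          rw [← hab, hn', hsn] at hdb
          exact left_eq_add.mp hdb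
        have hsig_eq : Λ.comp mu a = sig := hab.trans (hbv.comp_eq hb)
        exact Or.inr (comp_mem_graftPart hl hm hd hs ha hmn hn' (hsig_eq ▸ hsG hsn))
    · have hav : Λ.IsVertex a := by
        have hda := Λ.d_comp _ _ ha
        rw [hn', hmn] at hda
        exact left_eq_add.mp hda
      rw [hav.comp_eq (hs.trans ha)]
      exact hlG (hd.trans hmn)
  exact fun x hx => key hx.1 hx.2

theorem PiSet_finite (hΛ : Λ.FinitelyAligned) (hE : E.Finite) : (Λ.PiSet E).Finite := by
  have layer (n : Fin k → ℕ) : {x ∈ Λ.PiSet E | Λ.d x = n}.Finite := by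
    induction n using WellFoundedLT.induction with
    | ind n ih =>
      have hn : {x ∈ Λ.PiSet E | Λ.d x < n}.Finite := by
        have hI : {m | m < n}.Finite :=
          (Set.finite_Icc 0 n).subset fun m hm => ⟨zero_le, le_of_lt hm⟩
        exact (hI.biUnion ih).subset fun x hx => Set.mem_biUnion hx.2 ⟨hx.1, rfl⟩
      exact ((directPart_finite hΛ hE hn).union (graftPart_finite hΛ hE hn)).subset
        (PiSet_layer_subset n)
  obtain ⟨N, hN⟩ := exists_d_le_of_mem_PiSet hE
  exact ((Set.finite_Icc 0 N).biUnion fun n _ => layer n).subset fun x hx =>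
    Set.mem_biUnion ⟨zero_le, hN x hx⟩ ⟨hx, rfl⟩

end PiSet

end KGraph

section ListProd

variable {ι A : Type*}

theorem listProd_congr [Monoid A] {S T : Set ι} (h : S = T) {f g : ι → A} (hfg : f = g) :
    listProd S f = listProd T g := by rw [h, hfg]

theorem Commute.listProd_right [Monoid A] {S : Set ι} {f : ι → A} {x : A}
    (h : ∀ i ∈ S, Commute x (f i)) : Commute x (listProd S f) := by
  unfold listProd
  split_ifs with hS
  · refine Commute.list_prod_right _ _ ?_
    simpa using h
  · exact Commute.one_right x

theorem List.prod_map_mul_eq_zero [MonoidWithZero A] {l : List ι} {f : ι → A} {i : ι} {x : A}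
    (hc : ∀ a ∈ l, ∀ b ∈ l, Commute (f a) (f b)) (hi : i ∈ l) (hx : f i * x = 0) :
    (l.map f).prod * x = 0 := by
  induction l with
  | nil => simp at hi
  | cons b l ih =>
    rw [List.map_cons, List.prod_cons]
    obtain rfl | hi := List.mem_cons.1 hi
    · have : Commute (f i) (l.map f).prod := by
        refine Commute.list_prod_right _ _ ?_
        simp only [List.mem_map, forall_exists_index, and_imp, forall_apply_eq_imp_iff₂]
        exact fun a ha => hc i (by simp) a (by simp [ha])
      rw [this.eq, mul_assoc, hx, mul_zero]
    · rw [mul_assoc, ih (fun a ha b hb => hc a (by simp [ha]) b (by simp [hb])) hi, mul_zero]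

theorem listProd_mul_eq_zero [MonoidWithZero A] {S : Set ι} (hS : S.Finite) {f : ι → A}
    {i : ι} {x : A} (hc : ∀ a ∈ S, ∀ b ∈ S, Commute (f a) (f b)) (hi : i ∈ S)
    (hx : f i * x = 0) : listProd S f * x = 0 := by
  rw [listProd, dif_pos hS]
  exact List.prod_map_mul_eq_zero (by simpa using hc) (by simpa using hi) hx

theorem List.prod_map_isIdempotentElem [Monoid A] {l : List ι} {f : ι → A}
    (hc : ∀ a ∈ l, ∀ b ∈ l, Commute (f a) (f b)) (hi : ∀ a ∈ l, IsIdempotentElem (f a)) :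
    IsIdempotentElem (l.map f).prod := by
  induction l with
  | nil => exact IsIdempotentElem.one
  | cons b l ih =>
    rw [List.map_cons, List.prod_cons]
    refine IsIdempotentElem.mul_of_commute ?_ (hi b (by simp))
      (ih (fun a ha b hb => hc a (by simp [ha]) b (by simp [hb])) fun a ha => hi a (by simp [ha]))
    refine Commute.list_prod_right _ _ ?_
    simp only [List.mem_map, forall_exists_index, and_imp, forall_apply_eq_imp_iff₂]
    exact fun a ha => hc b (by simp) a (by simp [ha])

theorem listProd_isIdempotentElem [Monoid A] {S : Set ι} {f : ι → A}
    (hc : ∀ a ∈ S, ∀ b ∈ S, Commute (f a) (f b)) (hi : ∀ a ∈ S, IsIdempotentElem (f a)) :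
    IsIdempotentElem (listProd S f) := by
  unfold listProd
  split_ifs with hS
  · exact List.prod_map_isIdempotentElem (by simpa using hc) (by simpa using hi)
  · exact IsIdempotentElem.one

theorem List.prod_map_isSelfAdjoint [Monoid A] [StarMul A] {l : List ι} {f : ι → A}
    (hc : ∀ a ∈ l, ∀ b ∈ l, Commute (f a) (f b)) (hs : ∀ a ∈ l, IsSelfAdjoint (f a)) :
    IsSelfAdjoint (l.map f).prod := by
  induction l with
  | nil => exact IsSelfAdjoint.one A
  | cons b l ih =>
    rw [List.map_cons, List.prod_cons]
    refine ((hs b (by simp)).commute_iff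
      (ih (fun a ha b hb => hc a (by simp [ha]) b (by simp [hb]))
        fun a ha => hs a (by simp [ha]))).1 ?_
    refine Commute.list_prod_right _ _ ?_
    simp only [List.mem_map, forall_exists_index, and_imp, forall_apply_eq_imp_iff₂]
    exact fun a ha => hc b (by simp) a (by simp [ha])

theorem listProd_isSelfAdjoint [Monoid A] [StarMul A] {S : Set ι} {f : ι → A}
    (hc : ∀ a ∈ S, ∀ b ∈ S, Commute (f a) (f b)) (hs : ∀ a ∈ S, IsSelfAdjoint (f a)) :
    IsSelfAdjoint (listProd S f) := by
  unfold listProd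
  split_ifs with hS
  · exact List.prod_map_isSelfAdjoint (by simpa using hc) (by simpa using hs)
  · exact IsSelfAdjoint.one A

end ListProd

namespace KGraph

section Family

variable {k : ℕ} {Λ : KGraph k} {A : Type*} [Ring A] [StarRing A] {t : Λ.Path → A}

theorem TCKFamily.t_mul_t_s (ht : Λ.TCKFamily t) (lam : Λ.Path) :
    t lam * t (Λ.s lam) = t lam := by
  rw [ht.2.2.1 _ _ (Λ.r_s lam).symm, Λ.comp_source]

theorem TCKFamily.t_r_mul_t (ht : Λ.TCKFamily t) (lam : Λ.Path) :
    t (Λ.r lam) * t lam = t lam := by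
  rw [ht.2.2.1 _ _ (Λ.s_r lam), Λ.range_comp]

theorem TCKFamily.star_t_mul_t (ht : Λ.TCKFamily t) (lam : Λ.Path) :
    star (t lam) * t lam = t (Λ.s lam) := by
  have hv := ht.1 (Λ.s lam) (Λ.d_s lam)
  rw [ht.2.2.2, Lmin_self, finsum_mem_singleton, hv.1, hv.2]

theorem TCKFamily.t_mul_star_mul_t (ht : Λ.TCKFamily t) (lam : Λ.Path) :
    t lam * star (t lam) * t lam = t lam := by
  rw [mul_assoc, ht.star_t_mul_t, ht.t_mul_t_s]

theorem TCKFamily.commute_range_proj (ht : Λ.TCKFamily t) (hΛ : Λ.FinitelyAligned)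
    (lam mu : Λ.Path) : Commute (t lam * star (t lam)) (t mu * star (t mu)) := by
  refine ((IsSelfAdjoint.mul_star_self _).commute_iff (IsSelfAdjoint.mul_star_self _)).2 ?_
  have hfin := Lmin_finite hΛ lam mu
  have key : t lam * star (t lam) * (t mu * star (t mu)) =
      ∑ p ∈ hfin.toFinset, t (Λ.comp lam p.1) * star (t (Λ.comp lam p.1)) := by
    rw [mul_assoc, ← mul_assoc (star (t lam)), ht.2.2.2,
      finsum_mem_eq_finite_toFinset_sum _ hfin, Finset.sum_mul, Finset.mul_sum]
    refine Finset.sum_congr rfl fun p hp => ?_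
    rw [Set.Finite.mem_toFinset] at hp
    rw [mul_assoc, ← star_mul, ht.2.2.1 _ _ hp.2.1, ← mul_assoc, ht.2.2.1 _ _ hp.1, hp.2.2.1]
  rw [key, IsSelfAdjoint, star_sum]
  simp

/-- The index set of the product in the definition of `Theta`. -/
def gapSet (Λ : KGraph k) (E : Set Λ.Path) (lam : Λ.Path) : Set Λ.Path :=
  {nu | Λ.s lam = Λ.r nu ∧ ¬ Λ.IsVertex nu ∧ Λ.comp lam nu ∈ Λ.PiSet E}

theorem Theta_eq (t : Λ.Path → A) (E : Set Λ.Path) (lam mu : Λ.Path) :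
    Λ.Theta t E lam mu =
      t lam * Λ.gapProd t (Λ.s lam) (gapSet Λ E lam) * star (t mu) := rfl

theorem gapSet_finite {E : Set Λ.Path} (hP : (Λ.PiSet E).Finite) (lam : Λ.Path) :
    (gapSet Λ E lam).Finite := by
  refine Set.Finite.of_finite_image (f := Λ.comp lam) (hP.subset ?_) ?_
  · rintro _ ⟨nu, hnu, rfl⟩
    exact hnu.2.2
  · intro a ha b hb h
    exact (comp_inj ha.1 hb.1 rfl h).2

theorem gapSet_eq {E : Set Λ.Path} {lam mu : Λ.Path} (hl : lam ∈ Λ.PiSet E)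
    (hm : mu ∈ Λ.PiSet E) (hd : Λ.d lam = Λ.d mu) (hs : Λ.s lam = Λ.s mu) :
    gapSet Λ E lam = gapSet Λ E mu := by
  ext nu
  exact ⟨fun h => ⟨hs ▸ h.1, h.2.1,
      comp_mem_PiSet_of_comp_mem hm hl hd.symm hs.symm h.1 h.2.2⟩,
    fun h => ⟨hs ▸ h.1, h.2.1, comp_mem_PiSet_of_comp_mem hl hm hd hs h.1 h.2.2⟩⟩

theorem gapProd_gapSet_eq {E : Set Λ.Path} {lam mu : Λ.Path} (hl : lam ∈ Λ.PiSet E)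
    (hm : mu ∈ Λ.PiSet E) (hd : Λ.d lam = Λ.d mu) (hs : Λ.s lam = Λ.s mu) :
    Λ.gapProd t (Λ.s lam) (gapSet Λ E lam) = Λ.gapProd t (Λ.s mu) (gapSet Λ E mu) := by
  rw [hs, gapSet_eq hl hm hd hs]

variable {v : Λ.Path} {S : Set Λ.Path}

theorem TCKFamily.t_r_mul_range_proj (ht : Λ.TCKFamily t) (a : Λ.Path) :
    t (Λ.r a) * (t a * star (t a)) = t a * star (t a) := by
  rw [← mul_assoc, ht.t_r_mul_t]

theorem TCKFamily.range_proj_mul_t_r (ht : Λ.TCKFamily t) (a : Λ.Path) :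
    t a * star (t a) * t (Λ.r a) = t a * star (t a) := by
  have h := congrArg star (ht.t_r_mul_range_proj a)
  simpa [(ht.1 (Λ.r a) (Λ.d_r a)).1, mul_assoc] using h

theorem TCKFamily.commute_gap_factors (ht : Λ.TCKFamily t) (hΛ : Λ.FinitelyAligned)
    (hS : ∀ a ∈ S, v = Λ.r a) : ∀ a ∈ S, ∀ b ∈ S,
      Commute (t v - t a * star (t a)) (t v - t b * star (t b)) := by
  have hv (a) (ha : a ∈ S) : Commute (t v) (t a * star (t a)) := by
    rw [hS a ha]
    exact (ht.t_r_mul_range_proj a).trans (ht.range_proj_mul_t_r a).symm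
  intro a ha b hb
  exact ((Commute.refl _).sub_right (hv b hb)).sub_left
    ((hv a ha).symm.sub_right (ht.commute_range_proj hΛ a b))

theorem TCKFamily.commute_t_gapProd (ht : Λ.TCKFamily t) (hS : ∀ a ∈ S, v = Λ.r a) :
    Commute (t v) (Λ.gapProd t v S) := by
  refine Commute.listProd_right fun a ha => (Commute.refl _).sub_right ?_
  rw [hS a ha]
  exact (ht.t_r_mul_range_proj a).trans (ht.range_proj_mul_t_r a).symm

theorem TCKFamily.gapProd_isSelfAdjoint (ht : Λ.TCKFamily t) (hΛ : Λ.FinitelyAligned)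
    (hv : Λ.IsVertex v) (hS : ∀ a ∈ S, v = Λ.r a) : IsSelfAdjoint (Λ.gapProd t v S) :=
  listProd_isSelfAdjoint (ht.commute_gap_factors hΛ hS) fun _ _ =>
    IsSelfAdjoint.sub (ht.1 v hv).1 (IsSelfAdjoint.mul_star_self _)

theorem TCKFamily.gapProd_isIdempotentElem (ht : Λ.TCKFamily t) (hΛ : Λ.FinitelyAligned)
    (hS : ∀ a ∈ S, v = Λ.r a) : IsIdempotentElem (Λ.gapProd t v S) := by
  refine listProd_isIdempotentElem (ht.commute_gap_factors hΛ hS) fun a ha => ?_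
  have hq : t a * star (t a) * (t a * star (t a)) = t a * star (t a) := by
    rw [← mul_assoc, ht.t_mul_star_mul_t]
  rw [hS a ha, IsIdempotentElem, sub_mul, mul_sub, mul_sub, hq, ht.t_r_mul_range_proj,
    ht.range_proj_mul_t_r, (ht.1 _ (Λ.d_r a)).2, sub_self, sub_zero]

theorem TCKFamily.gapProd_mul_t (ht : Λ.TCKFamily t) (hΛ : Λ.FinitelyAligned)
    (hfin : S.Finite) (hS : ∀ a ∈ S, v = Λ.r a) {a : Λ.Path} (ha : a ∈ S) :
    Λ.gapProd t v S * t a = 0 := by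
  refine listProd_mul_eq_zero hfin (ht.commute_gap_factors hΛ hS) ha ?_
  rw [hS a ha, sub_mul, ht.t_r_mul_t, ht.t_mul_star_mul_t, sub_self]

theorem TCKFamily.star_t_mul_gapProd (ht : Λ.TCKFamily t) (hΛ : Λ.FinitelyAligned)
    (hv : Λ.IsVertex v) (hfin : S.Finite) (hS : ∀ a ∈ S, v = Λ.r a) {a : Λ.Path}
    (ha : a ∈ S) : star (t a) * Λ.gapProd t v S = 0 := by
  have h := congrArg star (ht.gapProd_mul_t hΛ hfin hS ha)
  rwa [star_mul, (ht.gapProd_isSelfAdjoint hΛ hv hS).star_eq, star_zero] at h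

end Family

end KGraph

/-- matrix-unit relations, (3.2) of the paper: for
`(λ,μ), (σ,τ) ∈ ΠE ×_{d,s} ΠE`, `(Θ(t)^{ΠE}_{λ,μ})* = Θ(t)^{ΠE}_{μ,λ}` and
`Θ(t)^{ΠE}_{λ,μ} Θ(t)^{ΠE}_{σ,τ} = δ_{μ,σ} Θ(t)^{ΠE}_{λ,τ}`. -/
theorem statement18 {k : ℕ} (Λ : KGraph k) (hΛ : Λ.FinitelyAligned)
    (E : Set Λ.Path) (hEfin : E.Finite)
    {A : Type*} [NormedRing A] [StarRing A] [CStarRing A] [NormedAlgebra ℂ A]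
    [CompleteSpace A] [StarModule ℂ A]
    (t : Λ.Path → A) (ht : Λ.TCKFamily t)
    (lam mu sig tau : Λ.Path)
    (hlam : lam ∈ Λ.PiSet E) (hmu : mu ∈ Λ.PiSet E)
    (hd1 : Λ.d lam = Λ.d mu) (hs1 : Λ.s lam = Λ.s mu)
    (hsig : sig ∈ Λ.PiSet E) (htau : tau ∈ Λ.PiSet E)
    (hd2 : Λ.d sig = Λ.d tau) (hs2 : Λ.s sig = Λ.s tau) :
    star (Λ.Theta t E lam mu) = Λ.Theta t E mu lam ∧
      Λ.Theta t E lam mu * Λ.Theta t E sig tau =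
        if mu = sig then Λ.Theta t E lam tau else 0 := by
  have hP := KGraph.PiSet_finite hΛ hEfin
  have hS (x : Λ.Path) : ∀ a ∈ KGraph.gapSet Λ E x, Λ.s x = Λ.r a := fun a ha => ha.1
  simp only [KGraph.Theta_eq]
  constructor
  · rw [star_mul, star_mul, star_star, KGraph.gapProd_gapSet_eq hlam hmu hd1 hs1,
      (ht.gapProd_isSelfAdjoint hΛ (Λ.d_s mu) (hS mu)).star_eq, mul_assoc]
  rw [KGraph.gapProd_gapSet_eq hlam hmu hd1 hs1]
  split_ifs with h
  · subst h
    set Q := Λ.gapProd t (Λ.s mu) (KGraph.gapSet Λ E mu)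
    have hQ : Q * Q = Q := ht.gapProd_isIdempotentElem hΛ (hS mu)
    have hc : t (Λ.s mu) * Q = Q * t (Λ.s mu) := ht.commute_t_gapProd (hS mu)
    calc t lam * Q * star (t mu) * (t mu * Q * star (t tau))
        = t lam * Q * (star (t mu) * t mu * Q) * star (t tau) := by simp only [mul_assoc]
      _ = t lam * (Q * t (Λ.s mu)) * Q * star (t tau) := by
          rw [ht.star_t_mul_t]; simp only [mul_assoc]
      _ = t lam * t (Λ.s lam) * (Q * Q) * star (t tau) := by
          rw [← hc, hs1]; simp only [mul_assoc]
      _ = t lam * Q * star (t tau) := by rw [ht.t_mul_t_s, hQ]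
  · set Q := Λ.gapProd t (Λ.s mu) (KGraph.gapSet Λ E mu)
    set R := Λ.gapProd t (Λ.s sig) (KGraph.gapSet Λ E sig)
    have hzero : Q * (star (t mu) * t sig) * R = 0 := by
      rw [ht.2.2.2, finsum_mem_eq_finite_toFinset_sum _ (KGraph.Lmin_finite hΛ mu sig),
        Finset.mul_sum, Finset.sum_mul]
      refine Finset.sum_eq_zero fun p hp => ?_
      rw [Set.Finite.mem_toFinset] at hp
      by_cases ha : Λ.IsVertex p.1
      · by_cases hb : Λ.IsVertex p.2
        · have he := hp.2.2.1
          rw [ha.comp_eq hp.1, hb.comp_eq hp.2.1] at he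
          exact absurd he h
        · have hmem : p.2 ∈ KGraph.gapSet Λ E sig :=
            ⟨hp.2.1, hb, KGraph.comp_mem_PiSet_of_mem_Lmin hsig hsig hmu rfl rfl
              (KGraph.swap_mem_Lmin hp)⟩
          rw [← mul_assoc, mul_assoc, ht.star_t_mul_gapProd hΛ (Λ.d_s sig)
            (KGraph.gapSet_finite hP sig) (hS sig) hmem, mul_zero]
      · have hmem : p.1 ∈ KGraph.gapSet Λ E mu :=
          ⟨hp.1, ha, KGraph.comp_mem_PiSet_of_mem_Lmin hmu hmu hsig rfl rfl hp⟩
        rw [← mul_assoc, ht.gapProd_mul_t hΛ (KGraph.gapSet_finite hP mu) (hS mu) hmem,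
          zero_mul, zero_mul]
    calc t lam * Q * star (t mu) * (t sig * R * star (t tau))
        = t lam * (Q * (star (t mu) * t sig) * R) * star (t tau) := by simp only [mul_assoc]
      _ = 0 := by rw [hzero, mul_zero, zero_mul]
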